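/- arXiv:2003.08497 — 2 statements merged into one kernel-verified Lean document; each statement's English description precedes it below -/
import Mathlib

section
/- Let (d⁻,d⁺) be a digraphical directed degree sequence of length n with M(d⁻,d⁺) > J⁻(d⁻,d⁺) + J⁺(d⁻,d⁺) + 8·(Δ⁻(d⁻) + Δ⁺(d⁺)) + 48. Then (d⁻,d⁺) is (12,12)-stable; that is, |Ω(d'⁻,d'⁺)| ≤ M(d⁻,d⁺)^{12} · |Ω(d⁻,d⁺)| for every digraphical (d'⁻,d'⁺) with ‖d'⁻ − d⁻‖₁ + ‖d'⁺ − d⁺‖₁ ≤ 12. -/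
open Finset

/-- The in-degree of vertex `i` in the arc set `A`. -/
def inDeg {n : ℕ} (A : Finset (Fin n × Fin n)) (i : Fin n) : ℕ :=
  (A.filter (fun a => a.2 = i)).card

/-- The out-degree of vertex `i` in the arc set `A`. -/
def outDeg {n : ℕ} (A : Finset (Fin n × Fin n)) (i : Fin n) : ℕ :=
  (A.filter (fun a => a.1 = i)).card

/-- `Ω(d⁻,d⁺)`: the set of loopless digraphs (arc sets) on `{1,…,n}` in which
vertex `i` has in-degree `d⁻ i` and out-degree `d⁺ i` for all `i`. -/
def OmegaDir {n : ℕ} (dm dp : Fin n → ℕ) : Set (Finset (Fin n × Fin n)) :=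
  {A | (∀ a ∈ A, a.1 ≠ a.2) ∧ (∀ i, inDeg A i = dm i) ∧ (∀ i, outDeg A i = dp i)}

/-- A directed degree sequence is digraphical if it is realised by a digraph. -/
def DigraphicalDir {n : ℕ} (dm dp : Fin n → ℕ) : Prop := (OmegaDir dm dp).Nonempty

/-- `M(d) = ∑ᵢ dᵢ`. -/
def Mdeg {n : ℕ} (d : Fin n → ℕ) : ℕ := ∑ i, d i

/-- `Δ(d)`, the maximum entry of `d`. -/
def Δdeg {n : ℕ} (d : Fin n → ℕ) : ℕ := Finset.univ.sup d

/-- The sum of the `k` largest entries of `d`, expressed as the maximum of the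
sum of `d` over the subsets of size `k`. -/
def sumLargest {n : ℕ} (k : ℕ) (d : Fin n → ℕ) : ℕ :=
  (Finset.univ.powersetCard k).sup (fun S => ∑ i ∈ S, d i)

/-- The ℓ₁ distance between two degree sequences. -/
def l1dist {n : ℕ} (d d' : Fin n → ℕ) : ℕ := ∑ i, ((d i : ℤ) - (d' i : ℤ)).natAbs

/-- A digraphical `(d⁻,d⁺)` is `(k,α)`-stable if
`|Ω(d'⁻,d'⁺)| ≤ M(d⁻,d⁺)^α |Ω(d⁻,d⁺)|` for every digraphical `(d'⁻,d'⁺)` with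
`‖d'⁻ - d⁻‖₁ + ‖d'⁺ - d⁺‖₁ ≤ k`. -/
def StableDir {n : ℕ} (k : ℕ) (α : ℝ) (dm dp : Fin n → ℕ) : Prop :=
  ∀ dm' dp' : Fin n → ℕ, DigraphicalDir dm' dp' →
    l1dist dm' dm + l1dist dp' dp ≤ k →
    ((OmegaDir dm' dp').ncard : ℝ) ≤ (Mdeg dm : ℝ) ^ α * ((OmegaDir dm dp).ncard : ℝ)

lemma step_bound {n : ℕ} (S T : Finset (Finset (Fin n × Fin n))) (M : ℕ) (hM : 48 ≤ M)
    (hT : ∀ B ∈ T, B.card ≤ M + 6)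
    (r0 : Finset (Fin n × Fin n) → Finset (Fin n × Fin n))
    (rc : Finset (Fin n × Fin n) → (Fin n × Fin n) → (Fin n × Fin n) →
      Finset (Fin n × Fin n) × (Fin n × Fin n))
    (h : ∀ A ∈ S, (∃ B ∈ T, r0 B = A) ∨
      (∃ e1 e2, e1 ≠ e2 ∧ ∀ e, (e = e1 ∨ e = e2) →
        ∃ B ∈ T, ∃ f1 ∈ B, ∃ f2 ∈ B, rc B f1 f2 = (A, e))) :
    S.card ≤ M ^ 2 * T.card := by
  classical
  set S1 := T.image r0 with hS1
  set P := (T.sigma (fun B => B ×ˢ B)).image (fun x => rc x.1 x.2.1 x.2.2) with hP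
  set S2 := S \ S1 with hS2
  have c1 : S1.card ≤ T.card := Finset.card_image_le
  have cP : P.card ≤ T.card * (M + 6) ^ 2 := by
    refine Finset.card_image_le.trans ?_
    rw [Finset.card_sigma]
    refine (Finset.sum_le_card_nsmul T _ ((M + 6) ^ 2) ?_).trans (by simp)
    intro B hB
    rw [Finset.card_product, sq]
    exact Nat.mul_le_mul (hT B hB) (hT B hB)
  have c2 : S2.card * 2 ≤ P.card := by
    have h1 : ∑ A ∈ S2, (P.filter (fun p => p.1 = A)).card ≤ P.card := by
      rw [← Finset.card_biUnion]
      · exact Finset.card_le_card (Finset.biUnion_subset.2 fun A _ => Finset.filter_subset _ _)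
      · intro A _ A' _ hAA
        rw [Function.onFun, Finset.disjoint_left]
        intro x hx hx'
        exact hAA ((Finset.mem_filter.1 hx).2.symm.trans (Finset.mem_filter.1 hx').2)
    refine le_trans ?_ h1
    refine le_trans (by simp) (Finset.card_nsmul_le_sum S2 _ 2 ?_)
    intro A hA
    rw [hS2, Finset.mem_sdiff] at hA
    obtain ⟨hA1, hA2⟩ := hA
    rcases h A hA1 with ⟨B, hB, hr⟩ | ⟨e1, e2, hne, he⟩
    · exact absurd (Finset.mem_image.2 ⟨B, hB, hr⟩) hA2
    · have hsub : ({(A, e1), (A, e2)} : Finset _) ⊆ P.filter (fun p => p.1 = A) := by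
        have key : ∀ e, (e = e1 ∨ e = e2) → (A, e) ∈ P.filter (fun p => p.1 = A) := by
          intro e hh
          obtain ⟨B, hB, f1, hf1, f2, hf2, hr⟩ := he e hh
          refine Finset.mem_filter.2 ⟨Finset.mem_image.2 ⟨⟨B, (f1, f2)⟩, ?_, hr⟩, rfl⟩
          simp [hB, hf1, hf2]
        intro p hp
        simp only [Finset.mem_insert, Finset.mem_singleton] at hp
        rcases hp with rfl | rfl
        · exact key _ (Or.inl rfl)
        · exact key _ (Or.inr rfl)
      have := Finset.card_le_card hsub
      rwa [Finset.card_pair (by simpa using hne)] at this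
  have c3 : S.card ≤ S1.card + S2.card := by
    have : S ⊆ S1 ∪ S2 := by
      intro a ha
      by_cases hh : a ∈ S1 <;> simp [hS2, ha, hh]
    exact (Finset.card_le_card this).trans (Finset.card_union_le _ _)
  have hq : 2 + (M + 6) ^ 2 ≤ 2 * M ^ 2 := by nlinarith
  have := Nat.mul_le_mul_left T.card hq
  nlinarith

lemma inDeg_switch {n : ℕ} (A R N : Finset (Fin n × Fin n)) (hR : R ⊆ A) (hN : Disjoint A N)
    (i : Fin n) : inDeg ((A \ R) ∪ N) i + inDeg R i = inDeg A i + inDeg N i := by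
  unfold inDeg
  rw [Finset.filter_union, Finset.card_union_of_disjoint]
  · have : A.filter (fun a => a.2 = i) = (A \ R).filter (fun a => a.2 = i) ∪ R.filter (fun a => a.2 = i) := by
      rw [← Finset.filter_union, Finset.sdiff_union_of_subset hR]
    rw [this, Finset.card_union_of_disjoint]
    · ring
    · exact Finset.disjoint_filter_filter Finset.sdiff_disjoint
  · exact Finset.disjoint_filter_filter (hN.mono_left Finset.sdiff_subset)

lemma outDeg_switch {n : ℕ} (A R N : Finset (Fin n × Fin n)) (hR : R ⊆ A) (hN : Disjoint A N)
    (i : Fin n) : outDeg ((A \ R) ∪ N) i + outDeg R i = outDeg A i + outDeg N i := by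
  unfold outDeg
  rw [Finset.filter_union, Finset.card_union_of_disjoint]
  · have : A.filter (fun a => a.1 = i) = (A \ R).filter (fun a => a.1 = i) ∪ R.filter (fun a => a.1 = i) := by
      rw [← Finset.filter_union, Finset.sdiff_union_of_subset hR]
    rw [this, Finset.card_union_of_disjoint]
    · ring
    · exact Finset.disjoint_filter_filter Finset.sdiff_disjoint
  · exact Finset.disjoint_filter_filter (hN.mono_left Finset.sdiff_subset)

lemma inDeg_empty {n : ℕ} (i : Fin n) : inDeg (∅ : Finset (Fin n × Fin n)) i = 0 := by
  simp [inDeg]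

lemma outDeg_empty {n : ℕ} (i : Fin n) : outDeg (∅ : Finset (Fin n × Fin n)) i = 0 := by
  simp [outDeg]

lemma inDeg_insert {n : ℕ} (e : Fin n × Fin n) (N : Finset (Fin n × Fin n)) (h : e ∉ N)
    (i : Fin n) : inDeg (insert e N) i = (if e.2 = i then 1 else 0) + inDeg N i := by
  unfold inDeg
  rw [Finset.filter_insert]
  split_ifs with hh
  · rw [Finset.card_insert_of_notMem (by simp [h])]; ring
  · simp

lemma outDeg_insert {n : ℕ} (e : Fin n × Fin n) (N : Finset (Fin n × Fin n)) (h : e ∉ N)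
    (i : Fin n) : outDeg (insert e N) i = (if e.1 = i then 1 else 0) + outDeg N i := by
  unfold outDeg
  rw [Finset.filter_insert]
  split_ifs with hh
  · rw [Finset.card_insert_of_notMem (by simp [h])]; ring
  · simp

lemma inDeg_single {n : ℕ} (e : Fin n × Fin n) (i : Fin n) :
    inDeg {e} i = (if e.2 = i then 1 else 0) := by
  have := inDeg_insert e ∅ (by simp) i
  simpa [inDeg_empty] using this

lemma outDeg_single {n : ℕ} (e : Fin n × Fin n) (i : Fin n) :
    outDeg {e} i = (if e.1 = i then 1 else 0) := by
  have := outDeg_insert e ∅ (by simp) i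
  simpa [outDeg_empty] using this

lemma card_out {n : ℕ} (A : Finset (Fin n × Fin n)) (Y : Finset (Fin n)) :
    (A.filter (fun e => e.1 ∈ Y)).card = ∑ i ∈ Y, outDeg A i := by
  rw [Finset.card_eq_sum_card_fiberwise (f := Prod.fst) (t := Y)]
  · refine Finset.sum_congr rfl fun i hi => ?_
    unfold outDeg
    congr 1
    ext e
    simp only [Finset.mem_filter]
    constructor
    · rintro ⟨⟨h1, _⟩, h3⟩; exact ⟨h1, h3⟩
    · rintro ⟨h1, h3⟩; exact ⟨⟨h1, h3 ▸ hi⟩, h3⟩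
  · intro e he
    simpa using (Finset.mem_filter.1 he).2

lemma card_in {n : ℕ} (A : Finset (Fin n × Fin n)) (Y : Finset (Fin n)) :
    (A.filter (fun e => e.2 ∈ Y)).card = ∑ i ∈ Y, inDeg A i := by
  rw [Finset.card_eq_sum_card_fiberwise (f := Prod.snd) (t := Y)]
  · refine Finset.sum_congr rfl fun i hi => ?_
    unfold inDeg
    congr 1
    ext e
    simp only [Finset.mem_filter]
    constructor
    · rintro ⟨⟨h1, _⟩, h3⟩; exact ⟨h1, h3⟩
    · rintro ⟨h1, h3⟩; exact ⟨⟨h1, h3 ▸ hi⟩, h3⟩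
  · intro e he
    simpa using (Finset.mem_filter.1 he).2

lemma card_all {n : ℕ} (A : Finset (Fin n × Fin n)) : A.card = ∑ i, inDeg A i := by
  rw [← card_in]; simp

lemma sum_le_largest {n : ℕ} (d : Fin n → ℕ) (k t : ℕ) (hk : k ≤ n) (Y : Finset (Fin n))
    (hY : Y.card ≤ k + t) : ∑ i ∈ Y, d i ≤ sumLargest k d + t * Δdeg d := by
  have base : ∀ Z : Finset (Fin n), Z.card ≤ k → ∑ i ∈ Z, d i ≤ sumLargest k d := by
    intro Z hZ
    obtain ⟨W, hW1, hW2⟩ := Finset.exists_superset_card_eq hZ (by simpa using hk)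
    refine (Finset.sum_le_sum_of_subset hW1).trans ?_
    unfold sumLargest
    exact Finset.le_sup (f := fun S => ∑ i ∈ S, d i) (by simp [Finset.mem_powersetCard, hW2])
  by_cases h : Y.card ≤ k
  · exact (base Y h).trans (Nat.le_add_right _ _)
  · obtain ⟨Z, hZ1, hZ2⟩ := Finset.exists_subset_card_eq (s := Y) (n := k) (by omega)
    rw [← Finset.sum_sdiff hZ1, add_comm]
    refine Nat.add_le_add (base Z hZ2.le) ?_
    refine (Finset.sum_le_card_nsmul (Y \ Z) d (Δdeg d) ?_).trans ?_
    · intro i _; exact Finset.le_sup (f := d) (Finset.mem_univ i)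
    · rw [Finset.card_sdiff_of_subset hZ1, hZ2, smul_eq_mul]
      exact Nat.mul_le_mul_right _ (by omega)

/-- positive part of the difference, summed -/
def exc {n : ℕ} (d d' : Fin n → ℕ) : ℕ := ∑ i, (d i - d' i)

lemma le_exc {n : ℕ} (d d' : Fin n → ℕ) (Y : Finset (Fin n)) :
    ∑ i ∈ Y, d i ≤ ∑ i ∈ Y, d' i + exc d d' := by
  have h1 : ∑ i ∈ Y, (d i - d' i) ≤ exc d d' :=
    Finset.sum_le_sum_of_subset (Finset.subset_univ Y)
  have h2 : ∑ i ∈ Y, d i ≤ ∑ i ∈ Y, (d' i + (d i - d' i)) :=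
    Finset.sum_le_sum fun i _ => by omega
  rw [Finset.sum_add_distrib] at h2
  omega

lemma le_exc_single {n : ℕ} (d d' : Fin n → ℕ) (v : Fin n) : d v ≤ Δdeg d' + exc d d' := by
  have := le_exc d d' {v}
  simp only [Finset.sum_singleton] at this
  have h2 : d' v ≤ Δdeg d' := Finset.le_sup (f := d') (Finset.mem_univ v)
  omega

lemma deg_le_n {n : ℕ} {dm dp : Fin n → ℕ} (hd : DigraphicalDir dm dp) :
    Δdeg dm ≤ n ∧ Δdeg dp ≤ n := by
  obtain ⟨A, -, h2, h3⟩ := hd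
  constructor
  · refine Finset.sup_le fun i _ => ?_
    rw [← h2 i]
    have : ((A.filter (fun a => a.2 = i)).image Prod.fst).card ≤ n := by
      simpa using Finset.card_le_univ ((A.filter (fun a => a.2 = i)).image Prod.fst)
    rwa [Finset.card_image_of_injOn] at this
    intro a ha b hb hab
    simp only [Finset.coe_filter, Set.mem_ofPred_eq] at ha hb
    exact Prod.ext hab (ha.2.trans hb.2.symm)
  · refine Finset.sup_le fun i _ => ?_
    rw [← h3 i]
    have : ((A.filter (fun a => a.1 = i)).image Prod.snd).card ≤ n := by
      simpa using Finset.card_le_univ ((A.filter (fun a => a.1 = i)).image Prod.snd)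
    rwa [Finset.card_image_of_injOn] at this
    intro a ha b hb hab
    simp only [Finset.coe_filter, Set.mem_ofPred_eq] at ha hb
    exact Prod.ext (ha.2.trans hb.2.symm) hab

/-- an arc usable for switching -/
def GoodArc {n : ℕ} (A : Finset (Fin n × Fin n)) (v w : Fin n) (e : Fin n × Fin n) : Prop :=
  e ∈ A ∧ (e.1, v) ∉ A ∧ e.1 ≠ v ∧ (w, e.2) ∉ A ∧ w ≠ e.2

lemma exists_good {n : ℕ} (dm dp : Fin n → ℕ) (hd : DigraphicalDir dm dp)
    (h : Mdeg dm >
      sumLargest (Δdeg dm) dp + sumLargest (Δdeg dp) dm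
        + 8 * (Δdeg dm + Δdeg dp) + 48)
    (dm' dp' : Fin n → ℕ) (h1 : exc dm' dm ≤ 6) (h2 : exc dp' dp ≤ 6) (h3 : exc dm dm' ≤ 6)
    (A : Finset (Fin n × Fin n)) (hA : A ∈ OmegaDir dm' dp') (v w : Fin n) :
    ∃ e1 e2, e1 ≠ e2 ∧ GoodArc A v w e1 ∧ GoodArc A v w e2 := by
  classical
  obtain ⟨hk1, hk2⟩ := deg_le_n hd
  obtain ⟨-, hAi, hAo⟩ := hA
  set Y := insert v ((A.filter (fun a => a.2 = v)).image Prod.fst) with hY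
  set Z := insert w ((A.filter (fun a => a.1 = w)).image Prod.snd) with hZ
  have cY : Y.card ≤ Δdeg dm + 7 := by
    rw [hY]
    have a1 := Finset.card_insert_le v ((A.filter (fun a => a.2 = v)).image Prod.fst)
    have a2 : ((A.filter (fun a => a.2 = v)).image Prod.fst).card ≤ dm' v := by
      rw [← hAi v]; exact Finset.card_image_le
    have := le_exc_single dm' dm v
    omega
  have cZ : Z.card ≤ Δdeg dp + 7 := by
    rw [hZ]
    have a1 := Finset.card_insert_le w ((A.filter (fun a => a.1 = w)).image Prod.snd)
    have a2 : ((A.filter (fun a => a.1 = w)).image Prod.snd).card ≤ dp' w := by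
      rw [← hAo w]; exact Finset.card_image_le
    have := le_exc_single dp' dp w
    omega
  have bY := sum_le_largest dp (Δdeg dm) 7 hk1 Y cY
  have bZ := sum_le_largest dm (Δdeg dp) 7 hk2 Z cZ
  have bY' := le_exc dp' dp Y
  have bZ' := le_exc dm' dm Z
  have fY := card_out A Y
  have fZ := card_in A Z
  have fA := card_all A
  simp only [hAi] at fZ fA
  simp only [hAo] at fY
  have bA := le_exc dm dm' Finset.univ
  have hMd : Mdeg dm = ∑ i, dm i := rfl
  set G := A.filter (fun e => e.1 ∉ Y ∧ e.2 ∉ Z) with hG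
  have hcov : A ⊆ G ∪ (A.filter (fun e => e.1 ∈ Y) ∪ A.filter (fun e => e.2 ∈ Z)) := by
    intro e he
    simp only [hG, Finset.mem_union, Finset.mem_filter]
    tauto
  have hc := Finset.card_le_card hcov
  have hc2 := Finset.card_union_le G (A.filter (fun e => e.1 ∈ Y) ∪ A.filter (fun e => e.2 ∈ Z))
  have hc3 := Finset.card_union_le (A.filter (fun e => e.1 ∈ Y)) (A.filter (fun e => e.2 ∈ Z))
  have hGc : 1 < G.card := by omega
  obtain ⟨e1, he1, e2, he2, hne⟩ := Finset.one_lt_card.1 hGc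
  have key : ∀ e ∈ G, GoodArc A v w e := by
    intro e he
    rw [hG, Finset.mem_filter] at he
    obtain ⟨g1, g2, g3⟩ := he
    simp only [hY, hZ, Finset.mem_insert, Finset.mem_image, Finset.mem_filter, not_or, not_exists] at g2 g3
    refine ⟨g1, ?_, g2.1, ?_, fun hh => g3.1 hh.symm⟩
    · intro hh; exact g2.2 (e.1, v) ⟨⟨hh, rfl⟩, rfl⟩
    · intro hh; exact g3.2 (w, e.2) ⟨⟨hh, rfl⟩, rfl⟩
  exact ⟨e1, e2, hne, key e1 he1, key e2 he2⟩

open Classical in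
/-- finset version of OmegaDir -/
noncomputable def Om {n : ℕ} (dm dp : Fin n → ℕ) : Finset (Finset (Fin n × Fin n)) :=
  Finset.univ.filter (fun A => A ∈ OmegaDir dm dp)

lemma mem_Om {n : ℕ} {dm dp : Fin n → ℕ} {A : Finset (Fin n × Fin n)} :
    A ∈ Om dm dp ↔ A ∈ OmegaDir dm dp := by simp [Om]

lemma ncard_Om {n : ℕ} (dm dp : Fin n → ℕ) : (OmegaDir dm dp).ncard = (Om dm dp).card := by
  rw [← Set.ncard_coe_finset]
  congr 1
  ext A
  simp [mem_Om]

lemma main_switch {n : ℕ} (dm dp : Fin n → ℕ) (hd : DigraphicalDir dm dp)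
    (h : Mdeg dm >
      sumLargest (Δdeg dm) dp + sumLargest (Δdeg dp) dm
        + 8 * (Δdeg dm + Δdeg dp) + 48)
    (dm' dp' : Fin n → ℕ) (h1 : exc dm' dm ≤ 6) (h2 : exc dp' dp ≤ 6) (h3 : exc dm dm' ≤ 6)
    (dm2 dp2 : Fin n → ℕ) (h4 : exc dm2 dm ≤ 6)
    (r0 : Finset (Fin n × Fin n) → Finset (Fin n × Fin n))
    (ρ : Fin n → Fin n → Finset (Fin n × Fin n))
    (hρ : ∀ v w, ∀ r ∈ ρ v w, r.2 = v ∨ r.1 = w)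
    (hh : ∀ A ∈ OmegaDir dm' dp', (∃ B ∈ OmegaDir dm2 dp2, r0 B = A) ∨
      ∃ v w, ρ v w ⊆ A ∧ (∀ i, dm2 i + inDeg (ρ v w) i = dm' i + (if v = i then 1 else 0)) ∧
        (∀ i, dp2 i + outDeg (ρ v w) i = dp' i + (if w = i then 1 else 0))) :
    (Om dm' dp').card ≤ (Mdeg dm) ^ 2 * (Om dm2 dp2).card := by
  classical
  refine step_bound (Om dm' dp') (Om dm2 dp2) (Mdeg dm) (by omega) ?_ r0
    (fun B f1 f2 => ((B \ {f1, f2}) ∪ insert (f1.1, f2.2) (ρ f1.2 f2.1), (f1.1, f2.2))) ?_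
  · intro B hB
    rw [mem_Om] at hB
    rw [card_all B]
    simp only [hB.2.1]
    have := le_exc dm2 dm Finset.univ
    unfold Mdeg
    omega
  · intro A hA
    rw [mem_Om] at hA
    rcases hh A hA with ⟨B, hB, hr⟩ | ⟨v, w, hsub, hi, ho⟩
    · exact Or.inl ⟨B, mem_Om.2 hB, hr⟩
    right
    obtain ⟨e1, e2, hne, g1, g2⟩ := exists_good dm dp hd h dm' dp' h1 h2 h3 A hA v w
    refine ⟨e1, e2, hne, ?_⟩
    intro e he
    have ge : GoodArc A v w e := by rcases he with rfl | rfl <;> assumption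
    clear he g1 g2 hne
    obtain ⟨a, b⟩ := e
    obtain ⟨q1, q2, q3, q4, q5⟩ := ge
    simp only at q2 q3 q4 q5
    have hR : insert (a, b) (ρ v w) ⊆ A := Finset.insert_subset q1 hsub
    have hN : Disjoint A {(a, v), (w, b)} := by
      rw [Finset.disjoint_right]
      intro x hx
      simp only [Finset.mem_insert, Finset.mem_singleton] at hx
      rcases hx with rfl | rfl <;> assumption
    have hab : (a, b) ∉ ρ v w := by
      intro hx
      rcases hρ v w _ hx with r | r
      · simp only at r; subst r; exact q2 q1
      · simp only at r; subst r; exact q4 q1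
    have hne : (a, v) ∉ ({(w, b)} : Finset (Fin n × Fin n)) := by
      simp only [Finset.mem_singleton, Prod.mk.injEq]
      rintro ⟨rfl, rfl⟩; exact q2 q1
    refine ⟨(A \ insert (a, b) (ρ v w)) ∪ {(a, v), (w, b)}, ?_, (a, v), by simp, (w, b), by simp, ?_⟩
    · rw [mem_Om]
      refine ⟨?_, ?_, ?_⟩
      · intro x hx
        simp only [Finset.mem_union, Finset.mem_sdiff, Finset.mem_insert, Finset.mem_singleton] at hx
        rcases hx with hx | rfl | rfl
        · exact hA.1 x hx.1
        · exact q3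
        · exact q5
      · intro i
        have s := inDeg_switch A _ _ hR hN i
        rw [inDeg_insert _ _ hab, inDeg_insert _ _ hne, inDeg_single, hA.2.1 i] at s
        have := hi i
        simp only at s
        omega
      · intro i
        have s := outDeg_switch A _ _ hR hN i
        rw [outDeg_insert _ _ hab, outDeg_insert _ _ hne, outDeg_single, hA.2.2 i] at s
        have := ho i
        simp only at s
        omega
    · simp only [Prod.mk.injEq, and_true]
      ext x
      have t1 : x ∈ insert (a, b) (ρ v w) → x ∈ A := fun z => hR z
      have t2 : x ∈ ({(a, v), (w, b)} : Finset _) → x ∉ A := fun z => Finset.disjoint_right.1 hN z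
      simp only [Finset.mem_union, Finset.mem_sdiff]
      tauto

lemma sum_ind {n : ℕ} (u : Fin n) : ∑ i, (if u = i then 1 else 0) = 1 := by simp

lemma exc_dec {n : ℕ} (d d' : Fin n → ℕ) (u : Fin n) (hu : d u < d' u) :
    exc (fun i => d' i - (if u = i then 1 else 0)) d + 1 = exc d' d ∧
    exc d (fun i => d' i - (if u = i then 1 else 0)) = exc d d' := by
  unfold exc
  constructor
  · have hs := sum_ind u
    refine (congrArg _ hs.symm).trans ?_
    rw [← Finset.sum_add_distrib]
    refine Finset.sum_congr rfl fun i _ => ?_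
    beta_reduce
    split_ifs with hi
    · subst hi; omega
    · omega
  · refine Finset.sum_congr rfl fun i _ => ?_
    beta_reduce
    split_ifs with hi
    · subst hi; omega
    · omega

lemma exc_inc {n : ℕ} (d d' : Fin n → ℕ) (u : Fin n) (hu : d' u < d u) :
    exc d (fun i => d' i + (if u = i then 1 else 0)) + 1 = exc d d' ∧
    exc (fun i => d' i + (if u = i then 1 else 0)) d = exc d' d := by
  unfold exc
  constructor
  · have hs := sum_ind u
    refine (congrArg _ hs.symm).trans ?_
    rw [← Finset.sum_add_distrib]
    refine Finset.sum_congr rfl fun i _ => ?_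
    beta_reduce
    split_ifs with hi
    · subst hi; omega
    · omega
  · refine Finset.sum_congr rfl fun i _ => ?_
    beta_reduce
    split_ifs with hi
    · subst hi; omega
    · omega

lemma exc_pos {n : ℕ} {d d' : Fin n → ℕ} (h : 0 < exc d d') : ∃ u, d' u < d u := by
  by_contra hc
  push Not at hc
  have : exc d d' = 0 := Finset.sum_eq_zero fun i _ => by have := hc i; omega
  omega

lemma exc_zero {n : ℕ} {d d' : Fin n → ℕ} (h : exc d d' = 0) (h' : exc d' d = 0) : d = d' := by
  funext i
  have a := Finset.sum_eq_zero_iff.1 h i (Finset.mem_univ i)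
  have b := Finset.sum_eq_zero_iff.1 h' i (Finset.mem_univ i)
  omega

lemma exists_in {n : ℕ} {A : Finset (Fin n × Fin n)} {u : Fin n} (h : 0 < inDeg A u) :
    ∃ x, (x, u) ∈ A := by
  obtain ⟨⟨x, y⟩, he⟩ := Finset.card_pos.1 h
  simp only [Finset.mem_filter] at he
  exact ⟨x, he.2 ▸ he.1⟩

lemma exists_out {n : ℕ} {A : Finset (Fin n × Fin n)} {u : Fin n} (h : 0 < outDeg A u) :
    ∃ x, (u, x) ∈ A := by
  obtain ⟨⟨x, y⟩, he⟩ := Finset.card_pos.1 h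
  simp only [Finset.mem_filter] at he
  exact ⟨y, he.2 ▸ he.1⟩

lemma induct {n : ℕ} (dm dp : Fin n → ℕ) (hd : DigraphicalDir dm dp)
    (h : Mdeg dm >
      sumLargest (Δdeg dm) dp + sumLargest (Δdeg dp) dm
        + 8 * (Δdeg dm + Δdeg dp) + 48) (k : ℕ) : k ≤ 6 → ∀ dm' dp' : Fin n → ℕ,
    exc dm' dm + exc dp dp' = k → exc dp' dp + exc dm dm' = k →
    (Om dm' dp').card ≤ (Mdeg dm) ^ (2 * k) * (Om dm dp).card := by
  induction k with
  | zero =>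
    intro _ dm' dp' h1 h2
    have e1 : dm' = dm := exc_zero (by omega) (by omega)
    have e2 : dp' = dp := exc_zero (by omega) (by omega)
    subst e1 e2
    simp
  | succ k ih =>
    intro hk dm' dp' h1 h2
    have red : ∀ dm2 dp2 : Fin n → ℕ, exc dm2 dm + exc dp dp2 = k → exc dp2 dp + exc dm dm2 = k →
        (Om dm' dp').card ≤ (Mdeg dm) ^ 2 * (Om dm2 dp2).card →
        (Om dm' dp').card ≤ (Mdeg dm) ^ (2 * (k + 1)) * (Om dm dp).card := by
      intro dm2 dp2 a b c
      refine c.trans ((Nat.mul_le_mul_left _ (ih (by omega) dm2 dp2 a b)).trans ?_)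
      apply le_of_eq; ring
    have p1 : (∃ u, dm u < dm' u) ∨ (∃ q, dp' q < dp q) := by
      by_cases hz : 0 < exc dm' dm
      · exact Or.inl (exc_pos hz)
      · exact Or.inr (exc_pos (by omega))
    have p2 : (∃ p, dp p < dp' p) ∨ (∃ v, dm' v < dm v) := by
      by_cases hz : 0 < exc dp' dp
      · exact Or.inl (exc_pos hz)
      · exact Or.inr (exc_pos (by omega))
    rcases p1 with ⟨u, hu⟩ | ⟨q, hq⟩ <;> rcases p2 with ⟨p, hp⟩ | ⟨v, hv⟩
    · -- deletion
      obtain ⟨a1, a2⟩ := exc_dec dm dm' u hu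
      obtain ⟨b1, b2⟩ := exc_dec dp dp' p hp
      refine red (fun i => dm' i - (if u = i then 1 else 0))
        (fun i => dp' i - (if p = i then 1 else 0)) (by omega) (by omega) ?_
      refine main_switch dm dp hd h dm' dp' (by omega) (by omega) (by omega) _ _ (by omega)
        (fun B => insert (p, u) B) (fun v w => {(p, v), (w, u)}) ?_ ?_
      · intro v w r hr
        simp only [Finset.mem_insert, Finset.mem_singleton] at hr
        rcases hr with rfl | rfl <;> simp
      · intro A hA
        by_cases hpu : (p, u) ∈ A
        · left
          refine ⟨A.erase (p, u), ⟨?_, ?_, ?_⟩, Finset.insert_erase hpu⟩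
          · intro a ha; exact hA.1 a (Finset.mem_of_mem_erase ha)
          · intro i
            have := inDeg_insert (p, u) (A.erase (p, u)) (by simp) i
            rw [Finset.insert_erase hpu, hA.2.1] at this
            simp only at this ⊢
            omega
          · intro i
            have := outDeg_insert (p, u) (A.erase (p, u)) (by simp) i
            rw [Finset.insert_erase hpu, hA.2.2] at this
            simp only at this ⊢
            omega
        · right
          obtain ⟨w, hw⟩ := exists_in (A := A) (u := u) (by rw [hA.2.1]; omega)
          obtain ⟨v, hv⟩ := exists_out (A := A) (u := p) (by rw [hA.2.2]; omega)
          have hne : (p, v) ∉ ({(w, u)} : Finset (Fin n × Fin n)) := by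
            simp only [Finset.mem_singleton, Prod.mk.injEq]
            rintro ⟨rfl, rfl⟩; exact hpu hw
          refine ⟨v, w, ?_, ?_, ?_⟩
          · intro x hx
            simp only [Finset.mem_insert, Finset.mem_singleton] at hx
            rcases hx with rfl | rfl <;> assumption
          · intro i
            rw [inDeg_insert _ _ hne, inDeg_single]
            simp only
            by_cases hi : u = i
            · subst hi; simp only [if_true]; omega
            · simp only [hi, if_false]; omega
          · intro i
            rw [outDeg_insert _ _ hne, outDeg_single]
            simp only
            by_cases hi : p = i
            · subst hi; simp only [if_true]; omega
            · simp only [hi, if_false]; omega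
    · -- in-degree move
      obtain ⟨a1, a2⟩ := exc_dec dm dm' u hu
      have huv : u ≠ v := by rintro rfl; omega
      obtain ⟨b1, b2⟩ := exc_inc dm (fun i => dm' i - (if u = i then 1 else 0)) v
        (by simp only [huv, if_false]; omega)
      refine red (fun i => dm' i - (if u = i then 1 else 0) + (if v = i then 1 else 0))
        dp' (by omega) (by omega) ?_
      refine main_switch dm dp hd h dm' dp' (by omega) (by omega) (by omega) _ _ (by omega)
        id (fun v w => {(w, u)}) ?_ ?_
      · intro v w r hr
        simp only [Finset.mem_singleton] at hr
        subst hr; simp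
      · intro A hA
        right
        obtain ⟨w, hw⟩ := exists_in (A := A) (u := u) (by rw [hA.2.1]; omega)
        refine ⟨v, w, by simpa using hw, ?_, ?_⟩
        · intro i
          rw [inDeg_single]
          simp only
          by_cases hi : u = i
          · subst hi; simp only [if_true]; omega
          · simp only [hi, if_false]; omega
        · intro i
          rw [outDeg_single]
    · -- out-degree move
      obtain ⟨a1, a2⟩ := exc_dec dp dp' p hp
      have huv : p ≠ q := by rintro rfl; omega
      obtain ⟨b1, b2⟩ := exc_inc dp (fun i => dp' i - (if p = i then 1 else 0)) q
        (by simp only [huv, if_false]; omega)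
      refine red dm' (fun i => dp' i - (if p = i then 1 else 0) + (if q = i then 1 else 0))
        (by omega) (by omega) ?_
      refine main_switch dm dp hd h dm' dp' (by omega) (by omega) (by omega) _ _ (by omega)
        id (fun v w => {(p, v)}) ?_ ?_
      · intro v w r hr
        simp only [Finset.mem_singleton] at hr
        subst hr; simp
      · intro A hA
        right
        obtain ⟨v, hv⟩ := exists_out (A := A) (u := p) (by rw [hA.2.2]; omega)
        refine ⟨v, q, by simpa using hv, ?_, ?_⟩
        · intro i
          rw [inDeg_single]
        · intro i
          rw [outDeg_single]
          simp only
          by_cases hi : p = i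
          · subst hi; simp only [if_true]; omega
          · simp only [hi, if_false]; omega
    · -- insertion
      obtain ⟨a1, a2⟩ := exc_inc dm dm' v hv
      obtain ⟨b1, b2⟩ := exc_inc dp dp' q hq
      refine red (fun i => dm' i + (if v = i then 1 else 0))
        (fun i => dp' i + (if q = i then 1 else 0)) (by omega) (by omega) ?_
      refine main_switch dm dp hd h dm' dp' (by omega) (by omega) (by omega) _ _ (by omega)
        id (fun v w => ∅) (by simp) ?_
      intro A hA
      right
      exact ⟨v, q, by simp, fun i => by simp [inDeg_empty], fun i => by simp [outDeg_empty]⟩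

lemma l1_exc {n : ℕ} (d d' : Fin n → ℕ) : l1dist d d' = exc d d' + exc d' d := by
  unfold l1dist exc
  rw [← Finset.sum_add_distrib]
  exact Finset.sum_congr rfl fun i _ => by omega

lemma sum_exc {n : ℕ} (d d' : Fin n → ℕ) : ∑ i, d i + exc d' d = ∑ i, d' i + exc d d' := by
  unfold exc
  rw [← Finset.sum_add_distrib, ← Finset.sum_add_distrib]
  exact Finset.sum_congr rfl fun i _ => by omega

lemma sum_eq_of_digraphical {n : ℕ} {dm dp : Fin n → ℕ} (hd : DigraphicalDir dm dp) :
    ∑ i, dm i = ∑ i, dp i := by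
  obtain ⟨A, -, h2, h3⟩ := hd
  have e1 := card_in A Finset.univ
  have e2 := card_out A Finset.univ
  simp only [h2, Finset.mem_univ, Finset.filter_true] at e1
  simp only [h3, Finset.mem_univ, Finset.filter_true] at e2
  omega

/-- Theorem 7.2 / `thm:stable-directed`: if
`M > J⁻ + J⁺ + 8(Δ⁻ + Δ⁺) + 48` then `(d⁻,d⁺)` is `(12,12)`-stable. -/
theorem stmt_14 {n : ℕ} (dm dp : Fin n → ℕ) (hsum : ∑ i, dm i = ∑ i, dp i)
    (hd : DigraphicalDir dm dp)
    (h : Mdeg dm >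
      sumLargest (Δdeg dm) dp + sumLargest (Δdeg dp) dm
        + 8 * (Δdeg dm + Δdeg dp) + 48) :
    StableDir 12 12 dm dp := by
  intro dm' dp' hd' hl
  have hs' := sum_eq_of_digraphical hd'
  rw [l1_exc, l1_exc] at hl
  have s1 := sum_exc dm dm'
  have s2 := sum_exc dp dp'
  have key := induct dm dp hd h (exc dm' dm + exc dp dp') (by omega) dm' dp' rfl (by omega)
  have hpow : (Mdeg dm) ^ (2 * (exc dm' dm + exc dp dp')) ≤ (Mdeg dm) ^ 12 :=
    Nat.pow_le_pow_right (by omega) (by omega)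
  have key2 : (OmegaDir dm' dp').ncard ≤ (Mdeg dm) ^ 12 * (OmegaDir dm dp).ncard := by
    rw [ncard_Om, ncard_Om]
    exact key.trans (Nat.mul_le_mul_right _ hpow)
  have e : ((Mdeg dm : ℝ)) ^ (12 : ℝ) = (Mdeg dm : ℝ) ^ (12 : ℕ) := by
    rw [← Real.rpow_natCast]; norm_num
  rw [e]
  exact_mod_cast key2
end

section
/- Let d be a graphical degree sequence of length n ≥ 2 with M(d) > 2·J(d) + 6·Δ(d) + 2. Then |Ω'(d)| ≤ n² · M(d)² · |Ω(d)|. -/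
open Finset

/-- The degree of vertex `i` in the simple graph `G`. -/
noncomputable def degOf {n : ℕ} (G : SimpleGraph (Fin n)) (i : Fin n) : ℕ :=
  (G.neighborSet i).ncard

/-- `Omega d` is the set of simple graphs on `{1,…,n}` with degree sequence `d`. -/
def Omega {n : ℕ} (d : Fin n → ℕ) : Set (SimpleGraph (Fin n)) :=
  {G | ∀ i, degOf G i = d i}

/-- A degree sequence is graphical if it is realised by some simple graph. -/
def Graphical {n : ℕ} (d : Fin n → ℕ) : Prop := (Omega d).Nonempty

/-- `J(d)`, the sum of the `Δ(d)` largest entries of `d`. -/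
def Jdeg {n : ℕ} (d : Fin n → ℕ) : ℕ := sumLargest (Δdeg d) d

/-- A graphical degree sequence `d` is `(k,α)`-stable if `|Ω(d')| ≤ M(d)^α |Ω(d)|`
for every graphical `d'` with `‖d' - d‖₁ ≤ k`. -/
def Stable {n : ℕ} (k : ℕ) (α : ℝ) (d : Fin n → ℕ) : Prop :=
  ∀ d' : Fin n → ℕ, Graphical d' → l1dist d' d ≤ k →
    ((Omega d').ncard : ℝ) ≤ (Mdeg d : ℝ) ^ α * ((Omega d).ncard : ℝ)

/-- `Ω'(d)`: union of `Ω(d')` over graphical `d' ≤ d` with `‖d - d'‖₁ ≤ 2`. -/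
def OmegaPrime {n : ℕ} (d : Fin n → ℕ) : Set (SimpleGraph (Fin n)) :=
  ⋃ d' ∈ {d' : Fin n → ℕ | Graphical d' ∧ (∀ j, d' j ≤ d j) ∧ l1dist d d' ≤ 2},
    Omega d'


section helpers
open Classical

lemma degOf_eq_sum {n : ℕ} (G : SimpleGraph (Fin n)) (i : Fin n) :
    degOf G i = ∑ j, if G.Adj i j then 1 else 0 := by
  rw [degOf, Set.ncard_eq_toFinset_card', Finset.sum_boole]
  simp only [Nat.cast_id]
  congr 1
  ext j
  simp

lemma degOf_eq_degree {n : ℕ} (G : SimpleGraph (Fin n)) (i : Fin n) :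
    degOf G i = G.degree i := by
  rw [degOf, Set.ncard_eq_toFinset_card', ← SimpleGraph.card_neighborFinset_eq_degree]
  rfl

lemma degOf_add {n : ℕ} (G : SimpleGraph (Fin n)) (u v : Fin n) (huv : u ≠ v)
    (h : ¬ G.Adj u v) (i : Fin n) :
    degOf (G ⊔ SimpleGraph.edge u v) i =
      degOf G i + (if i = u then 1 else 0) + (if i = v then 1 else 0) := by
  have h' : ¬ G.Adj v u := fun k => h k.symm
  have key : ∀ j, (if (G ⊔ SimpleGraph.edge u v).Adj i j then 1 else 0) =
      (if G.Adj i j then 1 else 0) + (if j = v then (if i = u then 1 else 0) else 0)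
        + (if j = u then (if i = v then 1 else 0) else 0) := by
    intro j
    simp only [SimpleGraph.sup_adj, SimpleGraph.edge_adj]
    by_cases h1 : i = u <;> by_cases h2 : i = v <;> by_cases h3 : j = u <;> by_cases h4 : j = v <;>
      simp_all
  rw [degOf_eq_sum, degOf_eq_sum]
  refine (Finset.sum_congr rfl (fun j _ => Eq.trans ?_ (key j))).trans ?_
  · congr
  · rw [Finset.sum_add_distrib, Finset.sum_add_distrib]
    simp

lemma sup_edge_sdiff {n : ℕ} (G : SimpleGraph (Fin n)) (u v : Fin n)
    (h : ¬ G.Adj u v) : (G ⊔ SimpleGraph.edge u v) \ SimpleGraph.edge u v = G := by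
  have h' : ¬ G.Adj v u := fun k => h k.symm
  ext i j
  simp only [SimpleGraph.sdiff_adj, SimpleGraph.sup_adj, SimpleGraph.edge_adj]
  constructor
  · tauto
  · intro k
    refine ⟨Or.inl k, ?_⟩
    rintro ⟨⟨rfl, rfl⟩ | ⟨rfl, rfl⟩, -⟩ <;> contradiction

lemma sdiff_edge_sup {n : ℕ} (G : SimpleGraph (Fin n)) (u v : Fin n)
    (h : G.Adj u v) : (G \ SimpleGraph.edge u v) ⊔ SimpleGraph.edge u v = G := by
  apply sdiff_sup_cancel
  intro i j
  simp only [SimpleGraph.edge_adj]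
  rintro ⟨⟨rfl, rfl⟩ | ⟨rfl, rfl⟩, -⟩
  · exact h
  · exact h.symm

lemma sum_le_J {n : ℕ} (d : Fin n → ℕ) (hd : Graphical d) (hn : 2 ≤ n) (S : Finset (Fin n))
    (hS : S.card ≤ Δdeg d) : ∑ i ∈ S, d i ≤ Jdeg d := by
  have hΔ : Δdeg d ≤ Fintype.card (Fin n) := by
    obtain ⟨G, hG⟩ := hd
    refine Finset.sup_le fun i _ => ?_
    rw [← hG i, degOf_eq_degree]
    exact (G.degree_lt_card_verts i).le
  obtain ⟨T, hST, hT⟩ := Finset.exists_superset_card_eq hS hΔ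
  calc ∑ i ∈ S, d i ≤ ∑ i ∈ T, d i := Finset.sum_le_sum_of_subset hST
    _ ≤ _ := by
      unfold Jdeg sumLargest
      exact Finset.le_sup (f := fun S => ∑ i ∈ S, d i)
        (by simp [Finset.mem_powersetCard, hT])

lemma even_M {n : ℕ} (d : Fin n → ℕ) (hd : Graphical d) : Even (∑ i, d i) := by
  obtain ⟨G, hG⟩ := hd
  have := G.sum_degrees_eq_twice_card_edges
  rw [← Finset.sum_congr rfl (fun i _ => hG i),
    Finset.sum_congr rfl (fun i _ => degOf_eq_degree G i), this]
  simp

lemma exists_edge {n : ℕ} (G : SimpleGraph (Fin n)) (A B : Finset (Fin n))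
    (h : ∑ i ∈ A, degOf G i + ∑ i ∈ B, degOf G i < ∑ i, degOf G i) :
    ∃ x y, G.Adj x y ∧ x ∉ A ∧ y ∉ B := by
  by_contra hc
  push Not at hc
  apply absurd h
  push Not
  have e1 : ∑ i ∈ A, degOf G i =
      ∑ x, ∑ y, if x ∈ A then (if G.Adj x y then 1 else 0) else 0 := by
    rw [← Finset.sum_filter_add_sum_filter_not univ (· ∈ A)]
    rw [Finset.sum_congr rfl (fun i _ => degOf_eq_sum G i)]
    rw [Finset.sum_eq_zero (s := univ.filter (· ∉ A))]
    · simp only [Finset.filter_univ_mem, add_zero]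
      refine Finset.sum_congr rfl fun x hx => ?_
      simp [hx]
    · intro x hx
      simp at hx
      simp [hx]
  have e2 : ∑ i ∈ B, degOf G i =
      ∑ x, ∑ y, if y ∈ B then (if G.Adj x y then 1 else 0) else 0 := by
    rw [Finset.sum_comm]
    rw [← Finset.sum_filter_add_sum_filter_not univ (· ∈ B)]
    rw [Finset.sum_congr rfl (fun i _ => degOf_eq_sum G i)]
    rw [Finset.sum_eq_zero (s := univ.filter (· ∉ B))]
    · simp only [Finset.filter_univ_mem, add_zero]
      refine Finset.sum_congr rfl fun x hx => ?_
      simp [hx, SimpleGraph.adj_comm]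
    · intro x hx
      simp at hx
      simp [hx]
  rw [e1, e2, ← Finset.sum_add_distrib, Finset.sum_congr rfl (fun i _ => degOf_eq_sum G i)]
  refine Finset.sum_le_sum fun x _ => ?_
  rw [← Finset.sum_add_distrib]
  refine Finset.sum_le_sum fun y _ => ?_
  have := hc x y
  by_cases h1 : G.Adj x y <;> by_cases h2 : x ∈ A <;> by_cases h3 : y ∈ B <;> simp_all

/-- Decoding map. -/
noncomputable def decG {n : ℕ} (a b : Fin n) (H : SimpleGraph (Fin n)) (p : Fin n × Fin n) :
    SimpleGraph (Fin n) :=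
  if p.1 = b then H \ SimpleGraph.edge a b
  else ((H \ SimpleGraph.edge b p.2) \ SimpleGraph.edge a p.1) ⊔ SimpleGraph.edge p.1 p.2

lemma exists_code {n : ℕ} (hn : 2 ≤ n) (d d' : Fin n → ℕ) (hd : Graphical d)
    (h : Mdeg d > 2 * Jdeg d + 6 * Δdeg d + 2) (a b : Fin n)
    (hab : ∀ i, d i = d' i + (if i = a then 1 else 0) + (if i = b then 1 else 0))
    (G : SimpleGraph (Fin n)) (hG : G ∈ Omega d') :
    ∃ H ∈ Omega d, ∃ x y, H.Adj a x ∧ H.Adj b y ∧ decG a b H (x, y) = G := by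
  by_cases hc : a ≠ b ∧ ¬ G.Adj a b
  · obtain ⟨hne, hadj⟩ := hc
    refine ⟨G ⊔ SimpleGraph.edge a b, fun i => ?_, b, a, ?_, ?_, ?_⟩
    · rw [degOf_add G a b hne hadj, hG i, hab i]
    · simp [SimpleGraph.edge_adj, hne]
    · simp [SimpleGraph.edge_adj, hne.symm]
    · simp [decG, sup_edge_sdiff G a b hadj]
  have hc' : a = b ∨ G.Adj a b := by tauto
  have hcard : ∀ c, (c = a ∨ c = b) → ∑ i ∈ insert c (G.neighborFinset c), degOf G i ≤ Jdeg d := by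
    intro c hcab
    calc _ ≤ ∑ i ∈ insert c (G.neighborFinset c), d i := by
          refine Finset.sum_le_sum fun i _ => ?_
          rw [hG i, hab i]; omega
      _ ≤ _ := by
          apply sum_le_J d hd hn
          have h1 := Finset.card_insert_le c (G.neighborFinset c)
          rw [SimpleGraph.card_neighborFinset_eq_degree, ← degOf_eq_degree, hG c] at h1
          have h2 : d c ≤ Δdeg d := Finset.le_sup (f := d) (Finset.mem_univ c)
          have h3 := hab c
          rcases hcab with rfl | rfl <;> simp at h3 <;> omega
  have hsum : Mdeg d = ∑ i, degOf G i + 2 := by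
    unfold Mdeg
    rw [Finset.sum_congr rfl (fun i _ => hab i), Finset.sum_add_distrib, Finset.sum_add_distrib,
      Finset.sum_congr rfl (fun i _ => hG i)]
    simp
  obtain ⟨x, y, hxy, hx, hy⟩ := exists_edge G (insert a (G.neighborFinset a))
    (insert b (G.neighborFinset b)) (by
      have := hcard a (Or.inl rfl)
      have := hcard b (Or.inr rfl)
      omega)
  simp only [Finset.mem_insert, SimpleGraph.mem_neighborFinset, not_or] at hx hy
  obtain ⟨hxa, hax⟩ := hx
  obtain ⟨hyb, hby⟩ := hy
  have hxne : x ≠ y := hxy.ne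
  have hxb : x ≠ b := by
    rintro rfl
    rcases hc' with h1 | h1
    · exact hxa h1.symm
    · exact hax h1
  have hya : y ≠ a := by
    rintro rfl
    rcases hc' with h1 | h1
    · exact hyb h1
    · exact hby h1.symm
  set G0 := G \ SimpleGraph.edge x y with hG0
  have hG0G : G0 ⊔ SimpleGraph.edge x y = G := sdiff_edge_sup G x y hxy
  have n0 : ¬ G0.Adj x y := by simp [hG0, SimpleGraph.edge_adj, hxne]
  have n1 : ¬ G0.Adj a x := fun k => hax k.1
  have n2 : ¬ (G0 ⊔ SimpleGraph.edge a x).Adj b y := by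
    simp only [SimpleGraph.sup_adj, SimpleGraph.edge_adj, not_or]
    refine ⟨fun k => hby k.1, ?_⟩
    rintro ⟨⟨-, h2⟩ | ⟨h1, -⟩, -⟩
    · exact hxne h2.symm
    · exact hxb h1.symm
  refine ⟨G0 ⊔ SimpleGraph.edge a x ⊔ SimpleGraph.edge b y, fun i => ?_, x, y, ?_, ?_, ?_⟩
  · rw [degOf_add _ b y (Ne.symm hyb) n2, degOf_add _ a x (Ne.symm hxa) n1, hab i, ← hG i]
    conv_rhs => rw [← hG0G]
    rw [degOf_add _ x y hxne n0]
    omega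
  · simp [SimpleGraph.edge_adj, Ne.symm hxa]
  · simp [SimpleGraph.edge_adj, Ne.symm hyb]
  · simp only [decG, hxb, if_false]
    rw [sup_edge_sdiff _ b y n2, sup_edge_sdiff _ a x n1, hG0G]

lemma card_le {n : ℕ} (hn : 2 ≤ n) (d d' : Fin n → ℕ) (hd : Graphical d)
    (h : Mdeg d > 2 * Jdeg d + 6 * Δdeg d + 2) (a b : Fin n)
    (hab : ∀ i, d i = d' i + (if i = a then 1 else 0) + (if i = b then 1 else 0)) :
    (Omega d').ncard ≤ Mdeg d ^ 2 * (Omega d).ncard := by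
  have hsub : Omega d' ⊆ ↑((Omega d).toFinset.biUnion fun H =>
      (H.neighborFinset a ×ˢ H.neighborFinset b).image (decG a b H)) := by
    intro G hG
    obtain ⟨H, hH, x, y, h1, h2, h3⟩ := exists_code hn d d' hd h a b hab G hG
    simp only [Finset.coe_biUnion, Set.mem_iUnion, Finset.coe_image, Set.mem_image,
      Finset.mem_coe, Set.mem_toFinset]
    exact ⟨H, hH, (x, y), by simp [h1, h2], h3⟩
  have hle : ∀ i, d i ≤ Mdeg d := fun i => Finset.single_le_sum (f := d) (by simp) (Finset.mem_univ i)
  calc (Omega d').ncard ≤ _ := Set.ncard_le_ncard hsub (Finset.finite_toSet _)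
    _ = _ := Set.ncard_coe_finset _
    _ ≤ (Omega d).toFinset.card * (Mdeg d ^ 2) := by
      refine Finset.card_biUnion_le_card_mul _ _ _ fun H hH => ?_
      refine Finset.card_image_le.trans ?_
      rw [Finset.card_product, SimpleGraph.card_neighborFinset_eq_degree,
        SimpleGraph.card_neighborFinset_eq_degree, ← degOf_eq_degree, ← degOf_eq_degree]
      have hH' : H ∈ Omega d := by simpa using hH
      rw [hH' a, hH' b, sq]
      exact Nat.mul_le_mul (hle a) (hle b)
    _ = _ := by rw [Set.ncard_eq_toFinset_card', mul_comm]

lemma exists_ab {n : ℕ} (d d' : Fin n → ℕ) (hd : Graphical d) (hd' : Graphical d')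
    (hle : ∀ j, d' j ≤ d j) (hl : l1dist d d' ≤ 2) : d = d' ∨ ∃ a b, a ≤ b ∧
    ∀ i, d i = d' i + (if i = a then 1 else 0) + (if i = b then 1 else 0) := by
  by_cases heq : d = d'
  · exact Or.inl heq
  right
  have h1 := even_M d hd
  have h2 := even_M d' hd'
  have h3 : ∑ i, d i = ∑ i, d' i + ∑ i, (d i - d' i) := by
    rw [← Finset.sum_add_distrib]
    exact Finset.sum_congr rfl fun i _ => by have := hle i; omega
  have h4 : ∑ i, (d i - d' i) ≤ 2 := by
    refine le_trans (le_of_eq ?_) hl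
    exact Finset.sum_congr rfl fun i _ => by have := hle i; omega
  obtain ⟨a, ha⟩ : ∃ a, d a ≠ d' a := Function.ne_iff.mp heq
  have hal := hle a
  have h5 : ∑ i, (d i - d' i) = ∑ i, (d i - d' i - if i = a then 1 else 0) + 1 := by
    have : ∑ i, (d i - d' i) =
        ∑ i, ((d i - d' i - if i = a then 1 else 0) + if i = a then 1 else 0) := by
      refine Finset.sum_congr rfl fun i _ => ?_
      by_cases hi : i = a
      · subst hi; simp; omega
      · simp [hi]
    rw [this, Finset.sum_add_distrib]
    simp
  have h6 : ∑ i, (d i - d' i - if i = a then 1 else 0) = 1 := by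
    rw [h3] at h1
    have := (Nat.even_add.mp h1).mp h2
    rw [h5] at this h4
    obtain ⟨k, hk⟩ := this
    omega
  obtain ⟨b, -, hb⟩ : ∃ b ∈ univ, (d b - d' b - if b = a then 1 else 0) ≠ 0 :=
    Finset.exists_ne_zero_of_sum_ne_zero (by rw [h6]; exact one_ne_zero)
  have h7 := Finset.add_sum_erase univ (fun i => d i - d' i - if i = a then 1 else 0)
    (Finset.mem_univ b)
  rw [h6] at h7
  have h8 : ∑ i ∈ univ.erase b, (d i - d' i - if i = a then 1 else 0) = 0 := by
    omega
  have key : ∀ i, d i = d' i + (if i = a then 1 else 0) + (if i = b then 1 else 0) := by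
    intro i
    have hi := hle i
    by_cases hib : i = b
    · subst hib
      by_cases hia : i = a
      · simp [hia] at h7 hb ⊢; subst hia; omega
      · simp [hia] at h7 hb ⊢; omega
    · have := (Finset.sum_eq_zero_iff.mp h8) i (by simp [hib])
      by_cases hia : i = a
      · subst hia
        simp [hib] at this ⊢; omega
      · simp [hia, hib] at this ⊢; omega
  rcases le_total a b with hab | hab
  · exact ⟨a, b, hab, key⟩
  · exact ⟨b, a, hab, fun i => by rw [key i]; omega⟩

end helpers

/-- if `n ≥ 2` and `M(d) > 2J(d) + 6Δ(d) + 2` then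
`|Ω'(d)| ≤ n² M(d)² |Ω(d)|`. -/
theorem stmt_16 {n : ℕ} (hn : 2 ≤ n) (d : Fin n → ℕ) (hd : Graphical d)
    (h : Mdeg d > 2 * Jdeg d + 6 * Δdeg d + 2) :
    (OmegaPrime d).ncard ≤ n ^ 2 * Mdeg d ^ 2 * (Omega d).ncard := by
  classical
  let S : Fin n × Fin n → Set (SimpleGraph (Fin n)) := fun p =>
    if p.1 ≤ p.2 then {G | ∃ d' : Fin n → ℕ, G ∈ Omega d' ∧
      ∀ i, d i = d' i + (if i = p.1 then 1 else 0) + (if i = p.2 then 1 else 0)}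
    else Omega d
  have hS : ∀ p, (S p).ncard ≤ Mdeg d ^ 2 * (Omega d).ncard := by
    rintro ⟨a, b⟩
    by_cases hab : a ≤ b
    · simp only [S, hab, if_true]
      by_cases hex : ∃ d' : Fin n → ℕ,
          ∀ i, d i = d' i + (if i = a then 1 else 0) + (if i = b then 1 else 0)
      · obtain ⟨d', hd'⟩ := hex
        refine le_trans (Set.ncard_le_ncard ?_ (Set.toFinite _)) (card_le hn d d' hd h a b hd')
        rintro G ⟨d'', hG, h2⟩
        have : d'' = d' := by
          funext i
          have := hd' i
          have := h2 i
          omega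
        exact this ▸ hG
      · rw [show {G | ∃ d' : Fin n → ℕ, G ∈ Omega d' ∧
          ∀ i, d i = d' i + (if i = a then 1 else 0) + (if i = b then 1 else 0)} = ∅ from ?_]
        · simp
        · ext G
          simp only [Set.mem_ofPred_eq, Set.mem_empty_iff_false, iff_false]
          rintro ⟨d', -, h2⟩
          exact hex ⟨d', h2⟩
    · simp only [S, hab, if_false]
      exact Nat.le_mul_of_pos_left _ (pow_pos (by omega) 2)
  have hsub : OmegaPrime d ⊆ ⋃ p, S p := by
    intro G hG
    simp only [OmegaPrime, Set.mem_iUnion, Set.mem_ofPred_eq] at hG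
    obtain ⟨d', ⟨hd', hle, hl⟩, hG⟩ := hG
    rw [Set.mem_iUnion]
    rcases exists_ab d d' hd hd' hle hl with heq | ⟨a, b, hab, hk⟩
    · refine ⟨(⟨1, by omega⟩, ⟨0, by omega⟩), ?_⟩
      simp [S, heq, hG]
    · refine ⟨(a, b), ?_⟩
      simp only [S, hab, if_true]
      exact ⟨d', hG, hk⟩
  calc (OmegaPrime d).ncard ≤ (⋃ p, S p).ncard := Set.ncard_le_ncard hsub (Set.toFinite _)
    _ ≤ ∑ p, (S p).ncard := Set.ncard_iUnion_le_of_fintype S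
    _ ≤ ∑ p : Fin n × Fin n, Mdeg d ^ 2 * (Omega d).ncard := Finset.sum_le_sum fun p _ => hS p
    _ = _ := by simp [sq, mul_assoc]
end
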